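/- Consider permutations of length n avoiding the classical pattern 1-2-3. (a) For n ≥ 2, the number of such permutations beginning with the pattern 12 equals C_{n-1}, and the number ending with the pattern 12 equals C_{n-1}. (b) For n ≥ 2 with n ≠ 3, the number of such permutations that both begin with the pattern 12 and end with the pattern 12 equals C_{n-2}, while for n = 3 this number is 0. -/

import Mathlib

/-- `π` avoids the classical pattern 1-2-3: there are no indices `i < j < k`
with `π i < π j < π k`. -/
def AvoidsC123 {n : ℕ} (π : Equiv.Perm (Fin n)) : Prop :=
  ¬ ∃ i j k : Fin n, i < j ∧ j < k ∧ π i < π j ∧ π j < π k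

/-- `π` begins with the pattern `12`: it has length at least 2 and
`π 1 < π 2`. -/
def BeginsInc12 {n : ℕ} (π : Equiv.Perm (Fin n)) : Prop :=
  ∃ h : 1 < n, π ⟨0, by omega⟩ < π ⟨1, h⟩

/-- `π` ends with the pattern `12`: it has length at least 2 and
`π (n-1) < π n`. -/
def EndsInc12 {n : ℕ} (π : Equiv.Perm (Fin n)) : Prop :=
  ∃ h : 1 < n, π ⟨n - 2, by omega⟩ < π ⟨n - 1, by omega⟩

namespace C123

def Dec {n : ℕ} (j : ℕ) (σ : Equiv.Perm (Fin n)) : Prop :=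
  ∀ a b : Fin n, a < b → b.val < j → σ b < σ a

noncomputable def T (n j : ℕ) : ℕ :=
  Nat.card {σ : Equiv.Perm (Fin n) // AvoidsC123 σ ∧ Dec j σ}

def ins {n : ℕ} (p : Fin (n+1)) (σ : Equiv.Perm (Fin n)) : Equiv.Perm (Fin (n+1)) :=
  (finSuccEquiv' p).trans ((Equiv.optionCongr σ).trans (finSuccEquiv' (Fin.last n)).symm)

lemma ins_self {n : ℕ} (p : Fin (n+1)) (σ : Equiv.Perm (Fin n)) : ins p σ p = Fin.last n := by
  simp [ins]

lemma ins_succAbove {n : ℕ} (p : Fin (n+1)) (σ : Equiv.Perm (Fin n)) (i : Fin n) :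
    ins p σ (p.succAbove i) = (σ i).castSucc := by
  simp [ins]

lemma ins_bij (n : ℕ) :
    Function.Bijective (fun x : (Σ _ : Fin (n+1), Equiv.Perm (Fin n)) => ins x.1 x.2) := by
  rw [Fintype.bijective_iff_injective_and_card]
  constructor
  · rintro ⟨p, σ⟩ ⟨q, τ⟩ h
    have h : ins p σ = ins q τ := h
    have hpq : p = q := by
      apply (ins q τ).injective
      rw [ins_self, ← h, ins_self]
    subst hpq
    have : σ = τ := by
      ext i
      have := ins_succAbove p σ i
      rw [h, ins_succAbove] at this
      have := Fin.castSucc_injective _ this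
      rw [this]
    rw [this]
  · simp [Fintype.card_perm, Nat.factorial_succ]

lemma card_ins (n : ℕ) (P : Equiv.Perm (Fin (n+1)) → Prop) :
    Nat.card {π // P π} = ∑ p : Fin (n+1), Nat.card {σ : Equiv.Perm (Fin n) // P (ins p σ)} := by
  rw [← Nat.card_sigma]
  symm
  refine Nat.card_eq_of_bijective
    (fun x : (Σ p : Fin (n+1), {σ : Equiv.Perm (Fin n) // P (ins p σ)}) =>
      (⟨ins x.1 x.2.1, x.2.2⟩ : {π // P π})) ⟨?_, ?_⟩
  · rintro ⟨p, σ, h1⟩ ⟨q, τ, h2⟩ h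
    have h := congrArg Subtype.val h
    have := (ins_bij n).1 (a₁ := ⟨p, σ⟩) (a₂ := ⟨q, τ⟩) h
    simp only [Sigma.mk.injEq, heq_eq_eq] at this
    obtain ⟨rfl, rfl⟩ := this
    rfl
  · rintro ⟨π, h⟩
    obtain ⟨⟨p, σ⟩, rfl⟩ := (ins_bij n).2 π
    exact ⟨⟨p, σ, h⟩, rfl⟩

lemma card_ins_single (n : ℕ) (P : Equiv.Perm (Fin (n+1)) → Prop) (Q : Equiv.Perm (Fin n) → Prop)
    (q : Fin (n+1)) (h : ∀ p σ, P (ins p σ) ↔ p = q ∧ Q σ) :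
    Nat.card {π // P π} = Nat.card {σ // Q σ} := by
  rw [card_ins, Finset.sum_eq_single q]
  · simp [h]
  · intro b _ hb
    simp [h, hb]
  · simp

lemma cases_p {n : ℕ} (p i : Fin (n+1)) : i = p ∨ ∃ a, i = p.succAbove a := by
  rcases eq_or_ne i p with h | h
  · exact Or.inl h
  · obtain ⟨a, rfl⟩ := Fin.exists_succAbove_eq h
    exact Or.inr ⟨a, rfl⟩

lemma sA_lt {n : ℕ} (p : Fin (n+1)) (a : Fin n) : p.succAbove a < p ↔ a.val < p.val := by
  rw [Fin.succAbove_lt_iff_castSucc_lt]; rfl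

lemma avoids_ins {n : ℕ} (p : Fin (n+1)) (σ : Equiv.Perm (Fin n)) :
    AvoidsC123 (ins p σ) ↔ AvoidsC123 σ ∧ Dec p.val σ := by
  constructor
  · intro h
    refine ⟨?_, ?_⟩
    · rintro ⟨i, j, k, hij, hjk, h1, h2⟩
      refine h ⟨p.succAbove i, p.succAbove j, p.succAbove k, ?_, ?_, ?_, ?_⟩
      · simpa using hij
      · simpa using hjk
      · simpa [ins_succAbove] using h1
      · simpa [ins_succAbove] using h2
    · intro a b hab hb
      by_contra hc
      have hlt : σ a < σ b := lt_of_le_of_ne (not_lt.1 hc) (fun e => hab.ne (σ.injective e))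
      refine h ⟨p.succAbove a, p.succAbove b, p, ?_, ?_, ?_, ?_⟩
      · simpa using hab
      · rwa [sA_lt]
      · simpa [ins_succAbove] using hlt
      · rw [ins_succAbove, ins_self]; exact Fin.castSucc_lt_last _
  · rintro ⟨h, hd⟩ ⟨i, j, k, hij, hjk, h1, h2⟩
    rcases cases_p p i with rfl | ⟨a, rfl⟩
    · rw [ins_self] at h1
      exact absurd (Fin.le_last _) (not_le.2 h1)
    rcases cases_p p j with rfl | ⟨b, rfl⟩
    · rw [ins_self] at h2
      exact absurd (Fin.le_last _) (not_le.2 h2)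
    have hab : a < b := by simpa using hij
    have h1' : σ a < σ b := by simpa [ins_succAbove] using h1
    rcases cases_p p k with rfl | ⟨c, rfl⟩
    · exact absurd (hd a b hab ((sA_lt _ _).1 hjk)) (not_lt.2 h1'.le)
    · exact h ⟨a, b, c, hab, by simpa using hjk, h1', by simpa [ins_succAbove] using h2⟩

lemma dec_zero {n : ℕ} (σ : Equiv.Perm (Fin n)) : Dec 0 σ := fun _ _ _ h => absurd h (by omega)

lemma dec_one {n : ℕ} (σ : Equiv.Perm (Fin n)) : Dec 1 σ := by
  intro a b h hb
  rw [Fin.lt_def] at h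
  omega

lemma dec_ins_zero {n : ℕ} (j : ℕ) (σ : Equiv.Perm (Fin n)) :
    Dec (j+1) (ins 0 σ) ↔ Dec j σ := by
  constructor
  · intro h a b hab hb
    have := h (Fin.succAbove 0 a) (Fin.succAbove 0 b) (by simpa using hab) (by simpa using hb)
    simpa only [ins_succAbove, Fin.castSucc_lt_castSucc_iff] using this
  · intro h a b hab hb
    rcases cases_p 0 b with rfl | ⟨b, rfl⟩
    · exact absurd (Fin.zero_le a) (not_le.2 hab)
    rcases cases_p 0 a with rfl | ⟨a, rfl⟩
    · rw [ins_self, ins_succAbove]; exact Fin.castSucc_lt_last _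
    simp only [ins_succAbove, Fin.castSucc_lt_castSucc_iff]
    exact h a b (by simpa using hab) (by simpa using hb)

lemma dec_ins_mid {n : ℕ} (j : ℕ) (p : Fin (n+1)) (hp : 0 < p.val) (hj : p.val ≤ j)
    (σ : Equiv.Perm (Fin n)) : ¬ Dec (j+1) (ins p σ) := by
  intro h
  have := h ⟨0, by omega⟩ p (by rw [Fin.lt_def]; exact hp) (by omega)
  rw [ins_self] at this
  exact absurd (Fin.le_last _) (not_le.2 this)

lemma dec_ins_big {n : ℕ} (j : ℕ) (p : Fin (n+1)) (hj : j < p.val)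
    (σ : Equiv.Perm (Fin n)) (hσ : Dec p.val σ) : Dec (j+1) (ins p σ) := by
  intro a b hab hb
  have hbp : b < p := by rw [Fin.lt_def]; omega
  have hap : a < p := hab.trans hbp
  rcases cases_p p b with rfl | ⟨b, rfl⟩
  · exact absurd hbp (lt_irrefl _)
  rcases cases_p p a with rfl | ⟨a, rfl⟩
  · exact absurd hap (lt_irrefl _)
  simp only [ins_succAbove, Fin.castSucc_lt_castSucc_iff]
  exact hσ a b (by simpa using hab) ((sA_lt _ _).1 hbp)

lemma T_rec (n j : ℕ) :
    T (n+1) (j+1) = T n j + ∑ i ∈ Finset.range n, if j ≤ i then T n (i+1) else 0 := by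
  rw [T, card_ins, Fin.sum_univ_succ, Finset.sum_range]
  congr 1
  · rw [T]
    refine Nat.card_congr (Equiv.subtypeEquivRight fun σ => ?_)
    rw [avoids_ins, dec_ins_zero]
    have := dec_zero σ
    simp [this]
  · refine Finset.sum_congr rfl fun i _ => ?_
    split_ifs with h
    · rw [T]
      refine Nat.card_congr (Equiv.subtypeEquivRight fun σ => ?_)
      rw [avoids_ins]
      constructor
      · rintro ⟨h1, -⟩; exact h1
      · rintro h1
        exact ⟨h1, dec_ins_big _ _ (by simp; omega) _ h1.2⟩
    · have : ∀ σ : Equiv.Perm (Fin n), ¬ Dec (j+1) (ins i.succ σ) :=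
        fun σ => dec_ins_mid _ _ (by simp) (by simp; omega) _
      simp [this]

lemma T_step (n j : ℕ) (h : j < n) : T (n+1) (j+1) = T (n+1) (j+2) + T n j := by
  rw [T_rec, T_rec n (j+1)]
  have : (∑ i ∈ Finset.range n, if j ≤ i then T n (i+1) else 0)
      = ∑ i ∈ Finset.range n, ((if j + 1 ≤ i then T n (i+1) else 0)
        + if i = j then T n (i+1) else 0) := by
    refine Finset.sum_congr rfl fun i _ => ?_
    split_ifs <;> omega
  rw [this, Finset.sum_add_distrib, Finset.sum_ite_eq', if_pos (by simpa using h)]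
  omega

lemma T_top (n : ℕ) : T (n+1) (n+1) = T n n := by
  rw [T_rec]
  rw [Finset.sum_eq_zero]
  · rfl
  · intro i hi
    rw [Finset.mem_range] at hi
    rw [if_neg (by omega)]

lemma T_zero_one (n : ℕ) : T n 0 = T n 1 := by
  simp [T, dec_zero, dec_one]

lemma T_formula (n : ℕ) : ∀ m, m ≤ n →
    T n (n - m) + (n+m).choose (n+1) = (n+m).choose n := by
  induction n with
  | zero =>
    intro m hm
    obtain rfl : m = 0 := by omega
    have : T 0 0 = 1 := by
      have : ∀ σ : Equiv.Perm (Fin 0), AvoidsC123 σ := fun σ ⟨i, _⟩ => i.elim0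
      simp [T, dec_zero, this]
    simp [this]
  | succ n ih =>
    intro m
    induction m with
    | zero =>
      intro _
      have := ih 0 (by omega)
      simp at this ⊢
      rw [T_top, this]
    | succ m ihm =>
      intro hm
      have h1 := ihm (by omega)
      have e1 : (n + 1 + (m+1)).choose (n+1) = (n+1+m).choose n + (n+1+m).choose (n+1) :=
        Nat.choose_succ_succ _ _
      have e2 : (n + 1 + (m+1)).choose (n+1+1) = (n+1+m).choose (n+1) + (n+1+m).choose (n+1+1) :=
        Nat.choose_succ_succ _ _
      rcases Nat.lt_or_ge m n with h | h
      · have h2 := ih (m+1) (by omega)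
        obtain ⟨j, rfl⟩ : ∃ j, n = j + 1 + m := ⟨n - m - 1, by omega⟩
        have h3 := T_step (j+1+m) j (by omega)
        rw [show j + 1 + m + 1 - m = j + 2 by omega] at h1
        rw [show j + 1 + m - (m+1) = j by omega,
          show j + 1 + m + (m+1) = j + 1 + m + 1 + m by omega] at h2
        rw [show j + 1 + m + 1 - (m+1) = j + 1 by omega]
        omega
      · obtain rfl : m = n := by omega
        rw [show m + 1 - m = 1 by omega] at h1
        rw [show m + 1 - (m+1) = 0 by omega, T_zero_one]
        have : (m+1+m).choose m = (m+1+m).choose (m+1) :=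
          Nat.choose_symm_of_eq_add (by omega)
        omega

lemma T_catalan (n : ℕ) : T n 0 = catalan n := by
  have h := T_formula n n le_rfl
  rw [Nat.sub_self] at h
  have h1 := succ_mul_catalan_eq_centralBinom n
  have h2 := Nat.choose_succ_right_eq (n+n) n
  rw [Nat.centralBinom, two_mul] at h1
  rw [Nat.add_sub_cancel] at h2
  have : (n+1) * T n 0 = (n+1) * catalan n := by
    rw [h1]; nlinarith
  exact Nat.eq_of_mul_eq_mul_left (by omega) this

lemma begins_ins {n : ℕ} (h1 : 1 < n + 1) (p : Fin (n+1)) (σ : Equiv.Perm (Fin n)) :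
    (AvoidsC123 (ins p σ) ∧ BeginsInc12 (ins p σ)) ↔ p = ⟨1, h1⟩ ∧ AvoidsC123 σ := by
  constructor
  · rintro ⟨h, hb, hlt⟩
    have hp : p = ⟨1, h1⟩ := by
      rcases lt_trichotomy p ⟨1, h1⟩ with hp | hp | hp
      · exfalso
        have : p = ⟨0, by omega⟩ := by
          rw [Fin.lt_def] at hp; ext; simp at hp ⊢; omega
        rw [← this, ins_self] at hlt
        exact absurd (Fin.le_last _) (not_le.2 hlt)
      · exact hp
      · exfalso
        refine h ⟨_, _, p, ?_, hp, hlt, ?_⟩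
        · rw [Fin.lt_def]; simp
        · rw [ins_self]
          refine lt_of_le_of_ne (Fin.le_last _) fun e => ?_
          rw [← ins_self p σ] at e
          exact hp.ne ((ins p σ).injective e)
    exact ⟨hp, ((avoids_ins _ _).1 h).1⟩
  · rintro ⟨rfl, h⟩
    refine ⟨(avoids_ins _ _).2 ⟨h, dec_one σ⟩, h1, ?_⟩
    rw [ins_self]
    refine lt_of_le_of_ne (Fin.le_last _) fun e => ?_
    rw [← ins_self ⟨1, h1⟩ σ] at e
    simpa using (ins ⟨1, h1⟩ σ).injective e

lemma card_begin (n : ℕ) (hn : 2 ≤ n) :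
    Nat.card {π : Equiv.Perm (Fin n) // AvoidsC123 π ∧ BeginsInc12 π} = catalan (n - 1) := by
  obtain ⟨n, rfl⟩ : ∃ m, n = m + 1 := ⟨n - 1, by omega⟩
  rw [card_ins_single n _ _ _ (begins_ins (by omega)), Nat.add_sub_cancel, ← T_catalan]
  simp [T, dec_zero]

def rc {n : ℕ} : Equiv.Perm (Fin n) ≃ Equiv.Perm (Fin n) := Equiv.permCongr Fin.revPerm

lemma rc_apply {n : ℕ} (π : Equiv.Perm (Fin n)) (i : Fin n) : rc π i = (π i.rev).rev := by
  simp [rc]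

lemma avoids_rc {n : ℕ} (π : Equiv.Perm (Fin n)) : AvoidsC123 (rc π) ↔ AvoidsC123 π := by
  unfold AvoidsC123
  refine not_congr ⟨?_, ?_⟩
  · rintro ⟨i, j, k, h1, h2, h3, h4⟩
    simp only [rc_apply, Fin.rev_lt_rev] at h3 h4
    exact ⟨k.rev, j.rev, i.rev, by simpa using h2, by simpa using h1, h4, h3⟩
  · rintro ⟨i, j, k, h1, h2, h3, h4⟩
    refine ⟨k.rev, j.rev, i.rev, by simpa using h2, by simpa using h1, ?_, ?_⟩ <;>
      simpa [rc_apply]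

lemma ends_rc {n : ℕ} (π : Equiv.Perm (Fin n)) : BeginsInc12 (rc π) ↔ EndsInc12 π := by
  unfold BeginsInc12 EndsInc12
  refine exists_congr fun h => ?_
  rw [rc_apply, rc_apply, Fin.rev_lt_rev]
  have e1 : Fin.rev (⟨1, h⟩ : Fin n) = ⟨n - 2, by omega⟩ := by ext; simp [Fin.val_rev]
  have e2 : Fin.rev (⟨0, by omega⟩ : Fin n) = ⟨n - 1, by omega⟩ := by ext; simp [Fin.val_rev]
  rw [e1, e2]

lemma card_end (n : ℕ) (hn : 2 ≤ n) :
    Nat.card {π : Equiv.Perm (Fin n) // AvoidsC123 π ∧ EndsInc12 π} = catalan (n - 1) := by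
  rw [← card_begin n hn]
  exact Nat.card_congr (rc.subtypeEquiv fun π => by rw [avoids_rc, ends_rc])

lemma ends_ins {n : ℕ} (hn : 3 ≤ n) (σ : Equiv.Perm (Fin n)) :
    EndsInc12 (ins ⟨1, by omega⟩ σ) ↔ EndsInc12 σ := by
  unfold EndsInc12
  have e : ∀ (i : ℕ) (h : i + 1 < n), (⟨i + 2, by omega⟩ : Fin (n+1))
      = Fin.succAbove ⟨1, by omega⟩ (⟨i + 1, h⟩ : Fin n) := by
    intro i h
    rw [Fin.succAbove_of_le_castSucc _ _ (by rw [Fin.le_def]; simp)]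
    rfl
  obtain ⟨m, rfl⟩ : ∃ m, n = m + 3 := ⟨n - 3, by omega⟩
  have e1 := e m (by omega)
  have e2 := e (m+1) (by omega)
  have key : ins ⟨1, by omega⟩ σ ⟨m+2, by omega⟩ < ins ⟨1, by omega⟩ σ ⟨m+1+2, by omega⟩ ↔
      σ ⟨m+1, by omega⟩ < σ ⟨m+1+1, by omega⟩ := by
    rw [e1, e2, ins_succAbove, ins_succAbove, Fin.castSucc_lt_castSucc_iff]
  constructor
  · rintro ⟨_, h⟩; exact ⟨by omega, key.1 h⟩
  · rintro ⟨_, h⟩; exact ⟨by omega, key.2 h⟩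

lemma card_both (n : ℕ) (hn : 4 ≤ n) :
    Nat.card {π : Equiv.Perm (Fin n) // AvoidsC123 π ∧ BeginsInc12 π ∧ EndsInc12 π}
      = catalan (n - 2) := by
  obtain ⟨n, rfl⟩ : ∃ m, n = m + 1 := ⟨n - 1, by omega⟩
  rw [show n + 1 - 2 = n - 1 by omega, ← card_end n (by omega)]
  refine card_ins_single n _ _ ⟨1, by omega⟩ fun p σ => ?_
  rw [← and_assoc, begins_ins (by omega), and_assoc]
  constructor
  · rintro ⟨rfl, h, h2⟩
    exact ⟨rfl, h, (ends_ins (by omega) σ).1 h2⟩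
  · rintro ⟨rfl, h, h2⟩
    exact ⟨rfl, h, (ends_ins (by omega) σ).2 h2⟩

end C123

theorem avoidC123_begin12_end12_count (n : ℕ) (hn : 2 ≤ n) :
    Nat.card {π : Equiv.Perm (Fin n) // AvoidsC123 π ∧ BeginsInc12 π} = catalan (n - 1) ∧
    Nat.card {π : Equiv.Perm (Fin n) // AvoidsC123 π ∧ EndsInc12 π} = catalan (n - 1) ∧
    (n ≠ 3 →
      Nat.card {π : Equiv.Perm (Fin n) // AvoidsC123 π ∧ BeginsInc12 π ∧ EndsInc12 π}
        = catalan (n - 2)) ∧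
    (n = 3 →
      Nat.card {π : Equiv.Perm (Fin n) // AvoidsC123 π ∧ BeginsInc12 π ∧ EndsInc12 π}
        = 0) := by
  refine ⟨C123.card_begin n hn, C123.card_end n hn, fun h => ?_, fun h => ?_⟩
  · rcases Nat.lt_or_ge n 4 with h4 | h4
    · obtain rfl : n = 2 := by omega
      have := C123.card_begin 2 le_rfl
      rw [show catalan (2 - 2) = catalan (2 - 1) by simp, ← this]
      refine Nat.card_congr (Equiv.subtypeEquivRight fun σ => ?_)
      constructor
      · rintro ⟨h1, h2, _⟩; exact ⟨h1, h2⟩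
      · rintro ⟨h1, h2⟩; exact ⟨h1, h2, h2⟩
    · exact C123.card_both n h4
  · subst h
    have : IsEmpty {π : Equiv.Perm (Fin 3) // AvoidsC123 π ∧ BeginsInc12 π ∧ EndsInc12 π} := by
      refine ⟨?_⟩
      rintro ⟨π, h, ⟨_, h1⟩, ⟨_, h2⟩⟩
      exact h ⟨0, 1, 2, by decide, by decide, h1, h2⟩
    simp
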